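/- Let d ≥ 2 be an integer, let {S_j} be a scale sequence and {b_j} a kernel sequence satisfying the flexible-needlet assumptions. Then for every N ∈ ℕ there exists a constant C(N, d) > 0 (independent of j and ℓ) such that for all j ≥ 1 and all integers ℓ ≥ S_{j−1}, |Υ_d^N(ℓ) b_j| ≤ C(N, d) · max{ 1/S_{j−1}^{2N}, 1/(S_j − S_{j−1})^{2N} }. -/

import Mathlib

noncomputable section

/-- `η_d = (d-1)/2`. -/
def etaD (d : ℕ) : ℝ := ((d : ℝ) - 1) / 2

/-- `ω_d = 2 π^((d+1)/2) / Γ((d+1)/2)`. -/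
def omegaD (d : ℕ) : ℝ :=
  2 * Real.pi ^ (((d : ℝ) + 1) / 2) / Real.Gamma (((d : ℝ) + 1) / 2)

/-- Gegenbauer polynomials `G_ℓ^{(η)}`, defined by the three-term recurrence
`G_0 = 1`, `G_1(x) = 2ηx`,
`(ℓ+1) G_{ℓ+1}(x) = 2(ℓ+η) x G_ℓ(x) − (ℓ+2η−1) G_{ℓ−1}(x)`. -/
def gegen (η : ℝ) : ℕ → ℝ → ℝ
  | 0 => fun _ => (1 : ℝ)
  | 1 => fun x => 2 * η * x
  | (n + 2) => fun x =>
      (2 * ((n : ℝ) + 1 + η) * x * gegen η (n + 1) x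
        - ((n : ℝ) + 1 + 2 * η - 1) * gegen η n x) / ((n : ℝ) + 2)

/-- The zonal kernel `Z_{ℓ;d}(t) = ((ℓ+η_d)/(η_d ω_d)) G_ℓ^{(η_d)}(t)`. -/
def Zker (d : ℕ) (ℓ : ℕ) (t : ℝ) : ℝ :=
  (((ℓ : ℝ) + etaD d) / (etaD d * omegaD d)) * gegen (etaD d) ℓ t

/-- Forward difference `(Δ⁺ r)_ℓ = r_{ℓ+1} − r_ℓ`. -/
def deltaPlus (r : ℕ → ℝ) : ℕ → ℝ := fun ℓ => r (ℓ + 1) - r ℓ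

/-- Backward difference `(Δ⁻ r)_ℓ = r_ℓ − r_{ℓ−1}`, with the convention `r_{−1} = 0`. -/
def deltaMinus (r : ℕ → ℝ) : ℕ → ℝ :=
  fun ℓ => r ℓ - (if ℓ = 0 then 0 else r (ℓ - 1))

/-- The operator `Υ_d`, `(Υ_d r)_ℓ = υ_{1;d}(ℓ) (Δ⁻Δ⁺ r)_ℓ + υ_{0;d}(ℓ) (Δ⁺ r)_ℓ`
with `υ_{1;d}(ℓ) = ℓ/(2(ℓ+η_d))` and `υ_{0;d}(ℓ) = 2η_d/(2(ℓ+η_d))`. -/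
def upsilon (d : ℕ) (r : ℕ → ℝ) : ℕ → ℝ :=
  fun ℓ =>
    ((ℓ : ℝ) / (2 * ((ℓ : ℝ) + etaD d))) * deltaMinus (deltaPlus r) ℓ
      + ((2 * etaD d) / (2 * ((ℓ : ℝ) + etaD d))) * deltaPlus r ℓ

/-- Uniform bound of order `p` for a family of sequences. -/
def Bd {ι : Type} (M : ι → ℝ) (p : ℕ) (f : ι → ℕ → ℝ) : Prop :=
  ∃ C : ℝ, 0 ≤ C ∧ ∀ i m, |f i m| ≤ C * M i ^ p

/-- Symbol-type class: differences up to order `K` gain powers of `M`. -/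
def SymOrd {ι : Type} (M : ι → ℝ) : ℕ → ℕ → (ι → ℕ → ℝ) → Prop
  | 0, p, f => Bd M p f
  | K + 1, p, f => Bd M p f ∧ SymOrd M K (p + 1) (fun i => deltaPlus (f i))

theorem SymOrd.bd {ι : Type} {M : ι → ℝ} {K p : ℕ} {f : ι → ℕ → ℝ} (h : SymOrd M K p f) :
    Bd M p f := by
  cases K with
  | zero => exact h
  | succ K => exact h.1

theorem SymOrd.pred {ι : Type} {M : ι → ℝ} {K p : ℕ} {f : ι → ℕ → ℝ} (h : SymOrd M (K + 1) p f) :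
    SymOrd M K p f := by
  induction K generalizing p f with
  | zero => exact h.1
  | succ K ih => exact ⟨h.1, ih h.2⟩

theorem SymOrd.shift {ι : Type} {M : ι → ℝ} {K p : ℕ} {f : ι → ℕ → ℝ} (h : SymOrd M K p f) :
    SymOrd M K p (fun i m => f i (m + 1)) := by
  have hb : ∀ {p : ℕ} {f : ι → ℕ → ℝ}, Bd M p f → Bd M p (fun i m => f i (m + 1)) := by
    rintro p f ⟨C, hC, h⟩
    exact ⟨C, hC, fun i m => h i (m + 1)⟩
  induction K generalizing p f with
  | zero => exact hb h
  | succ K ih => exact ⟨hb h.1, ih h.2⟩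

theorem SymOrd.add {ι : Type} {M : ι → ℝ} {K p : ℕ} {f g : ι → ℕ → ℝ} (hf : SymOrd M K p f)
    (hg : SymOrd M K p g) : SymOrd M K p (fun i m => f i m + g i m) := by
  have hb : ∀ {p : ℕ} {f g : ι → ℕ → ℝ}, Bd M p f → Bd M p g →
      Bd M p (fun i m => f i m + g i m) := by
    rintro p f g ⟨C, hC, h⟩ ⟨D, hD, h'⟩
    refine ⟨C + D, by positivity, fun i m => ?_⟩
    have := abs_add_le (f i m) (g i m)
    have := h i m
    have := h' i m
    dsimp only
    linarith
  induction K generalizing p f g with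
  | zero => exact hb hf hg
  | succ K ih =>
    refine ⟨hb hf.1 hg.1, ?_⟩
    convert ih hf.2 hg.2 using 1
    funext i m
    simp only [deltaPlus]
    ring

theorem SymOrd.smul {ι : Type} {M : ι → ℝ} {K p : ℕ} {f : ι → ℕ → ℝ} (a : ℝ) (hf : SymOrd M K p f) :
    SymOrd M K p (fun i m => a * f i m) := by
  have hb : ∀ {p : ℕ} {f : ι → ℕ → ℝ}, Bd M p f → Bd M p (fun i m => a * f i m) := by
    rintro p f ⟨C, hC, h⟩
    refine ⟨|a| * C, by positivity, fun i m => ?_⟩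
    dsimp only
    rw [abs_mul, mul_assoc]
    exact mul_le_mul_of_nonneg_left (h i m) (abs_nonneg a)
  induction K generalizing p f with
  | zero => exact hb hf
  | succ K ih =>
    refine ⟨hb hf.1, ?_⟩
    convert ih hf.2 using 1
    funext i m
    simp only [deltaPlus]
    ring

theorem SymOrd.mul {ι : Type} {M : ι → ℝ} {K p q : ℕ} {f g : ι → ℕ → ℝ}
    (hf : SymOrd M K p f) (hg : SymOrd M K q g) : SymOrd M K (p + q) (fun i m => f i m * g i m) := by
  have hb : ∀ {p q : ℕ} {f g : ι → ℕ → ℝ}, Bd M p f → Bd M q g →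
      Bd M (p + q) (fun i m => f i m * g i m) := by
    rintro p q f g ⟨C, hC, h⟩ ⟨D, hD, h'⟩
    refine ⟨C * D, by positivity, fun i m => ?_⟩
    have h1 := mul_le_mul (h i m) (h' i m) (abs_nonneg _) ((abs_nonneg _).trans (h i m))
    dsimp only
    rw [abs_mul, pow_add]
    linarith
  induction K generalizing p q f g with
  | zero => exact hb hf hg
  | succ K ih =>
    refine ⟨hb hf.1 hg.1, ?_⟩
    have h1 := ih hf.2 hg.pred
    have h2 := ih hf.shift.pred hg.2
    rw [show p + 1 + q = p + q + 1 by ring] at h1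
    rw [show p + (q + 1) = p + q + 1 by ring] at h2
    convert h1.add h2 using 1
    funext i m
    simp only [deltaPlus]
    ring

theorem ord_inv {ι : Type} {M : ι → ℝ} (x : ι → ℝ) (hx : ∀ i, 0 < x i)
    (hM : ∀ i, 1 / x i ≤ 2 * M i) (K : ℕ) : SymOrd M K 1 (fun i m => 1 / (x i + (m : ℝ))) := by
  have hb : Bd M 1 (fun i m => 1 / (x i + (m : ℝ))) := by
    refine ⟨2, by norm_num, fun i m => ?_⟩
    have h0 := hx i
    have h1 : 1 / (x i + (m : ℝ)) ≤ 1 / x i :=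
      one_div_le_one_div_of_le h0 (by linarith [Nat.cast_nonneg (α := ℝ) m])
    rw [abs_of_nonneg (by positivity), pow_one]
    exact h1.trans (hM i)
  induction K with
  | zero => exact hb
  | succ K ih =>
    refine ⟨hb, ?_⟩
    convert (ih.shift.mul ih).smul (-1) using 1
    funext i m
    simp only [deltaPlus]
    have h0 := hx i
    have h1 : x i + (m : ℝ) ≠ 0 := by positivity
    have h2 : x i + ((m + 1 : ℕ) : ℝ) ≠ 0 := by positivity
    field_simp
    push_cast
    ring

theorem ord_smooth {ι : Type} {M : ι → ℝ} (K p : ℕ) (A : ℕ → ℝ) (hA : ∀ n, 0 ≤ A n)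
    (g : ι → ℝ → ℝ) (hg : ∀ i, ContDiff ℝ (⊤ : ℕ∞) (g i))
    (hb : ∀ i n u, |iteratedDeriv n (g i) u| ≤ A n * M i ^ (p + n)) (a : ι → ℝ) :
    SymOrd M K p (fun i m => g i (a i + (m : ℝ))) := by
  induction K generalizing p A g with
  | zero => exact ⟨A 0, hA 0, fun i m => by simpa using hb i 0 (a i + m)⟩
  | succ K ih =>
    refine ⟨⟨A 0, hA 0, fun i m => by simpa using hb i 0 (a i + m)⟩, ?_⟩
    have hc : ∀ i, ContDiff ℝ (⊤ : ℕ∞) (fun u => g i (u + 1)) := fun i =>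
      (hg i).comp (contDiff_id.add contDiff_const)
    have := ih (p + 1) (fun n => A (n + 1)) (fun n => hA _)
      (fun i u => g i (u + 1) - g i u) (fun i => (hc i).sub (hg i)) ?_
    · convert this using 1
      funext i m
      simp only [deltaPlus]
      push_cast
      rw [add_assoc]
    · intro i n u
      have hle : ((n : ℕ∞) : WithTop ℕ∞) ≤ ((⊤ : ℕ∞) : WithTop ℕ∞) := by
        exact_mod_cast le_top
      have e : iteratedDeriv n (fun u => g i (u + 1) - g i u) u
          = iteratedDeriv n (g i) (u + 1) - iteratedDeriv n (g i) u := by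
        have := iteratedDeriv_fun_sub (x := u) (((hc i).of_le hle).contDiffAt)
          (((hg i).of_le hle).contDiffAt)
        rw [this, iteratedDeriv_comp_add_const]
      rw [e]
      have hd : Differentiable ℝ (iteratedDeriv n (g i)) :=
        (hg i).differentiable_iteratedDeriv n (by exact_mod_cast WithTop.coe_lt_top _)
      have := Convex.norm_image_sub_le_of_norm_deriv_le (f := iteratedDeriv n (g i))
        (C := A (n + 1) * M i ^ (p + (n + 1))) (s := Set.univ) (x := u) (y := u + 1)
        (fun x _ => hd x)
        (fun x _ => by rw [← iteratedDeriv_succ]; exact hb i (n + 1) x)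
        convex_univ trivial trivial
      simp only [Real.norm_eq_abs, add_sub_cancel_left, abs_one, mul_one] at this
      rw [show p + 1 + n = p + (n + 1) by ring]
      exact this

theorem upsilon_succ (d : ℕ) (hd : 2 ≤ d) (r : ℕ → ℝ) (m : ℕ) :
    upsilon d r (m + 1) = 1 / 2 * deltaPlus (deltaPlus r) m +
      etaD d / 2 * ((1 / ((m : ℝ) + 1 + etaD d)) * (deltaPlus r (m + 1) + deltaPlus r m)) := by
  have hη : 0 < etaD d := by
    have : (2 : ℝ) ≤ d := by exact_mod_cast hd
    unfold etaD
    linarith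
  have h1 : (m : ℝ) + 1 + etaD d ≠ 0 := by positivity
  simp only [upsilon, deltaMinus, Nat.succ_ne_zero, if_false, Nat.add_sub_cancel]
  rw [show deltaPlus (deltaPlus r) m = deltaPlus r (m + 1) - deltaPlus r m from rfl]
  push_cast
  field_simp
  ring

theorem upsilon_iter_ord {ι : Type} {M : ι → ℝ} (d : ℕ) (hd : 2 ≤ d) (a : ι → ℕ)
    (ha : ∀ i, 0 < a i) (hM : ∀ i, 1 / (a i : ℝ) ≤ 2 * M i) (r : ι → ℕ → ℝ)
    (hr : ∀ K, SymOrd M K 0 (fun i m => r i (a i + m))) (n : ℕ) :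
    ∀ K, SymOrd M K (2 * n) (fun i m => (upsilon d)^[n] (r i) (a i + n + m)) := by
  have hη : 0 < etaD d := by
    have : (2 : ℝ) ≤ d := by exact_mod_cast hd
    unfold etaD
    linarith
  induction n with
  | zero => exact hr
  | succ n ih =>
    intro K
    have h2 := (ih (K + 2)).2.2
    have h1 := (ih (K + 1)).2
    have hu := ord_inv (M := M) (fun i => (a i : ℝ) + n + 1 + etaD d)
      (fun i => by positivity) (fun i => by
        refine le_trans (one_div_le_one_div_of_le (by exact_mod_cast ha i) ?_) (hM i)
        linarith [Nat.cast_nonneg (α := ℝ) n]) K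
    have h3 := hu.mul (h1.shift.add h1)
    rw [show 1 + (2 * n + 1) = 2 * n + 1 + 1 by ring] at h3
    rw [show 2 * (n + 1) = 2 * n + 1 + 1 by ring]
    convert (h2.smul (1 / 2)).add (h3.smul (etaD d / 2)) using 1
    funext i m
    rw [Function.iterate_succ_apply', show a i + (n + 1) + m = (a i + n + m) + 1 by ring,
      upsilon_succ d hd]
    simp only [deltaPlus]
    push_cast
    rw [show (a i : ℝ) + n + m + 1 + etaD d = a i + n + 1 + etaD d + m by ring]
    rfl

theorem upsilon_bound (d : ℕ) (hd : 2 ≤ d) (r : ℕ → ℝ) (B : ℝ) (hr : ∀ m, |r m| ≤ B) (m : ℕ) :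
    |upsilon d r m| ≤ 4 * B := by
  have hη : 0 < etaD d := by
    have : (2 : ℝ) ≤ d := by exact_mod_cast hd
    unfold etaD
    linarith
  have hp : ∀ m, |deltaPlus r m| ≤ 2 * B := fun m => by
    have := abs_sub (r (m + 1)) (r m)
    have := hr m
    have := hr (m + 1)
    simp only [deltaPlus]
    linarith
  have hB : 0 ≤ B := (abs_nonneg _).trans (hr 0)
  cases m with
  | zero =>
    have := hp 0
    simp only [upsilon, Nat.cast_zero, zero_div, zero_mul, zero_add]
    rw [div_self (by positivity), one_mul]
    linarith
  | succ m =>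
    rw [upsilon_succ d hd]
    have h0 := hp m
    have h1 := hp (m + 1)
    have hc0 : 0 ≤ etaD d / ((m : ℝ) + 1 + etaD d) := by positivity
    have hc : etaD d / ((m : ℝ) + 1 + etaD d) ≤ 1 := by
      rw [div_le_one (by positivity)]
      linarith [Nat.cast_nonneg (α := ℝ) m]
    have e : etaD d / 2 * ((1 / ((m : ℝ) + 1 + etaD d)) * (deltaPlus r (m + 1) + deltaPlus r m))
      = etaD d / ((m : ℝ) + 1 + etaD d) * ((deltaPlus r (m + 1) + deltaPlus r m) / 2) := by ring
    rw [e]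
    have k1 : |(deltaPlus r (m + 1) + deltaPlus r m) / 2| ≤ 2 * B := by
      rw [abs_le] at *
      constructor <;> linarith [h0.1, h0.2, h1.1, h1.2]
    have k2 : |etaD d / ((m : ℝ) + 1 + etaD d) * ((deltaPlus r (m + 1) + deltaPlus r m) / 2)|
        ≤ 2 * B := by
      rw [abs_mul, abs_of_nonneg hc0]
      nlinarith [abs_nonneg ((deltaPlus r (m + 1) + deltaPlus r m) / 2)]
    have k3 : |1 / 2 * deltaPlus (deltaPlus r) m| ≤ 2 * B := by
      rw [show deltaPlus (deltaPlus r) m = deltaPlus r (m + 1) - deltaPlus r m from rfl]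
      rw [abs_le] at h0 h1 ⊢
      constructor <;> linarith [h0.1, h0.2, h1.1, h1.2]
    linarith [abs_add_le (1 / 2 * deltaPlus (deltaPlus r) m)
      (etaD d / ((m : ℝ) + 1 + etaD d) * ((deltaPlus r (m + 1) + deltaPlus r m) / 2))]

theorem upsilon_iter_bound (d : ℕ) (hd : 2 ≤ d) (r : ℕ → ℝ) (B : ℝ) (hr : ∀ m, |r m| ≤ B)
    (n : ℕ) : ∀ m, |(upsilon d)^[n] r m| ≤ 4 ^ n * B := by
  induction n with
  | zero => simpa using hr
  | succ n ih =>
    intro m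
    rw [Function.iterate_succ_apply', pow_succ, mul_comm ((4 : ℝ) ^ n), mul_assoc]
    exact upsilon_bound d hd _ _ ih m

theorem max_pow_aux (x y : ℝ) (hx : 0 < x) (hy : 0 < y) (n : ℕ) :
    (max (1 / x) (1 / y)) ^ n = max (1 / x ^ n) (1 / y ^ n) := by
  have hx' : 0 ≤ 1 / x := by positivity
  have hy' : 0 ≤ 1 / y := by positivity
  rw [← one_div_pow, ← one_div_pow]
  rcases le_total (1 / x) (1 / y) with h | h
  · rw [max_eq_right h, max_eq_right (pow_le_pow_left₀ hx' h n)]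
  · rw [max_eq_left h, max_eq_left (pow_le_pow_left₀ hy' h n)]

/-- **Bound on iterated `Υ_d` applied to flexible-needlet kernels.**
Under the flexible-needlet assumptions, for every `N` there is `C(N,d) > 0` with
`|Υ_d^N(ℓ) b_j| ≤ C(N,d) max{1/S_{j−1}^{2N}, 1/(S_j − S_{j−1})^{2N}}`
for all `j ≥ 1` and all integers `ℓ ≥ S_{j−1}`. -/
theorem upsilon_iterate_kernel_bound
    (d : ℕ) (hd : 2 ≤ d) (S : ℕ → ℝ) (b : ℕ → ℝ → ℝ) (K : ℕ → ℝ)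
    -- scale sequence assumptions
    (hS0 : S 0 = 1) (hSpos : ∀ j, 0 < S j) (hSmono : StrictMono S)
    (hStop : Filter.Tendsto S Filter.atTop Filter.atTop)
    (hSconv : ∀ j : ℕ, S (j + 1) - S j ≤ S (j + 2) - S (j + 1))
    -- kernel sequence assumptions
    (hbC : ∀ j, ContDiff ℝ (⊤ : ℕ∞) (b j))
    (hb01 : ∀ j, ∀ u : ℝ, 0 ≤ u → b j u ∈ Set.Icc (0 : ℝ) 1)
    (hbderiv : ∀ j n : ℕ, 1 ≤ j → 1 ≤ n →
      ∀ u : ℝ, |iteratedDeriv n (b j) u| ≤ K n / (S j - S (j - 1)) ^ n)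
    (hbsupp : ∀ j : ℕ, 1 ≤ j → ∀ u : ℝ, (u < S (j - 1) ∨ S (j + 1) < u) → b j u = 0)
    (hbval : ∀ j : ℕ, 1 ≤ j →
      b j (S (j - 1)) = 0 ∧ b j (S (j + 1)) = 0 ∧ b j (S j) = 1)
    (hbpart : ∀ u : ℝ, 1 ≤ u → ∑' j : ℕ, (b j u) ^ 2 = 1) :
    ∀ N : ℕ, ∃ C : ℝ, 0 < C ∧
      ∀ j : ℕ, 1 ≤ j → ∀ ℓ : ℕ, S (j - 1) ≤ (ℓ : ℝ) →
        |((upsilon d)^[N] (fun m : ℕ => b j (m : ℝ))) ℓ| ≤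
          C * max (1 / S (j - 1) ^ (2 * N)) (1 / (S j - S (j - 1)) ^ (2 * N)) := by
  intro N
  have hh : ∀ j, 1 ≤ j → 0 < S j - S (j - 1) := fun j hj =>
    sub_pos.2 (hSmono (by omega))
  have hb1 : ∀ j, 1 ≤ j → ∀ u, |b j u| ≤ 1 := by
    intro j hj u
    rcases lt_or_ge u 0 with hu | hu
    · rw [hbsupp j hj u (Or.inl (hu.trans (hSpos _)))]
      simp
    · have := hb01 j u hu
      rw [abs_le]
      constructor <;> linarith [this.1, this.2]
  let ι : Type := {x : ℕ × ℕ // 1 ≤ x.1 ∧ 0 < x.2 ∧ S (x.1 - 1) ≤ 2 * (x.2 : ℝ)}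
  let M : ι → ℝ := fun i => max (1 / S (i.1.1 - 1)) (1 / (S i.1.1 - S (i.1.1 - 1)))
  have hord := upsilon_iter_ord (M := M) d hd (fun i : ι => i.1.2) (fun i => i.2.2.1)
    (fun i => by
      have h1 := i.2.2.2
      have h2 := hSpos (i.1.1 - 1)
      have h3 : 1 / (2 * (i.1.2 : ℝ)) ≤ 1 / S (i.1.1 - 1) := one_div_le_one_div_of_le h2 h1
      have h4 : 1 / S (i.1.1 - 1) ≤ M i := le_max_left _ _
      have h5 : 1 / (i.1.2 : ℝ) = 2 * (1 / (2 * (i.1.2 : ℝ))) := by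
        have : (i.1.2 : ℝ) ≠ 0 := by exact_mod_cast i.2.2.1.ne'
        field_simp
      rw [h5]
      linarith)
    (fun i m => b i.1.1 (m : ℝ))
    (fun k => by
      have := ord_smooth (M := M) k 0 (fun n => 1 + |K n|) (fun n => by positivity)
        (fun i => b i.1.1) (fun i => hbC _) (fun i n u => ?_) (fun i => (i.1.2 : ℝ))
      · simpa using this
      · have hpos := hh i.1.1 i.2.1
        have hM0 : 0 ≤ 1 / (S i.1.1 - S (i.1.1 - 1)) := by positivity
        have hM1 : 1 / (S i.1.1 - S (i.1.1 - 1)) ≤ M i := le_max_right _ _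
        rcases Nat.eq_zero_or_pos n with rfl | hn
        · have := hb1 i.1.1 i.2.1 u
          simp only [iteratedDeriv_zero, add_zero, pow_zero, mul_one]
          linarith [abs_nonneg (K 0)]
        · refine (hbderiv i.1.1 n i.2.1 hn u).trans ?_
          have hp := pow_le_pow_left₀ hM0 hM1 n
          rw [one_div_pow] at hp
          have hp0 : 0 ≤ 1 / (S i.1.1 - S (i.1.1 - 1)) ^ n := by positivity
          rw [zero_add, div_eq_mul_one_div]
          exact mul_le_mul (by linarith [le_abs_self (K n)]) hp hp0 (by positivity))
    N 0
  obtain ⟨C, hC, hCb⟩ := hord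
  refine ⟨C + 4 ^ N * (2 * N : ℝ) ^ (2 * N) + 1, by positivity, ?_⟩
  intro j hj ℓ hℓ
  have hSp := hSpos (j - 1)
  have hhp := hh j hj
  rw [← max_pow_aux _ _ hSp hhp]
  have hMnn : 0 ≤ max (1 / S (j - 1)) (1 / (S j - S (j - 1))) :=
    le_trans (by positivity) (le_max_left _ _)
  have hMp := pow_nonneg hMnn (2 * N)
  have hQ : 0 ≤ 4 ^ N * (2 * N : ℝ) ^ (2 * N) := by positivity
  have hℓ0 : 0 < ℓ := by
    have : (0 : ℝ) < ℓ := lt_of_lt_of_le hSp hℓ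
    exact_mod_cast this
  by_cases hbig : 2 * N ≤ ℓ
  · have hsub : ((ℓ - N : ℕ) : ℝ) = (ℓ : ℝ) - N := by
      rw [Nat.cast_sub (by omega)]
    have hbig' : (2 : ℝ) * N ≤ ℓ := by exact_mod_cast hbig
    have := hCb ⟨(j, ℓ - N), hj, by dsimp only; omega, by dsimp only; rw [hsub]; linarith⟩ 0
    dsimp only at this
    rw [show ℓ - N + N + 0 = ℓ by omega] at this
    refine this.trans ?_
    exact mul_le_mul_of_nonneg_right (by linarith) hMp
  · have h1 := upsilon_iter_bound d hd (fun m : ℕ => b j (m : ℝ)) 1 (fun m => hb1 j hj _) N ℓ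
    have hlt : (ℓ : ℝ) ≤ 2 * N := by
      have : ℓ ≤ 2 * N := by omega
      exact_mod_cast this
    have h2 : 1 ≤ (2 * N : ℝ) * max (1 / S (j - 1)) (1 / (S j - S (j - 1))) := by
      calc (1 : ℝ) = S (j - 1) * (1 / S (j - 1)) := by field_simp
        _ ≤ (2 * N : ℝ) * max (1 / S (j - 1)) (1 / (S j - S (j - 1))) :=
          mul_le_mul (hℓ.trans hlt) (le_max_left _ _) (by positivity) (by positivity)
    have h3 := one_le_pow₀ h2 (n := 2 * N)
    rw [mul_pow] at h3
    have h4 : (0 : ℝ) < 4 ^ N := by positivity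
    have h5 := mul_le_mul_of_nonneg_left h3 h4.le
    have h6 : 0 ≤ (C + 1) * max (1 / S (j - 1)) (1 / (S j - S (j - 1))) ^ (2 * N) := by
      positivity
    linarith
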